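/- (Theorem 1: sufficient condition for robust stability.) Let n ≥ 1, β ∈ ℂ, and let L, U be real n×n matrices with L i j ≤ U i j entrywise. Suppose there exists a complex n×n Hermitian positive-definite matrix P such that M(P, V) is negative definite for every vertex matrix V ∈ 𝒱. Then for every A ∈ 𝒜 there exists a complex n×n Hermitian positive-definite matrix P_A (possibly depending on A) such that M(P_A, A) is negative definite. -/

import Mathlib

open Matrix ComplexOrder

/-- `M(P, A) := β • (P * A) + (conj β) • (Aᵀ * P)`, with the real matrix `A`
coerced entrywise to `ℂ`. -/
noncomputable def Mmat {n : ℕ} (β : ℂ) (P : Matrix (Fin n) (Fin n) ℂ)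
    (A : Matrix (Fin n) (Fin n) ℝ) : Matrix (Fin n) (Fin n) ℂ :=
  β • (P * A.map Complex.ofReal) + (starRingEnd ℂ β) • ((A.map Complex.ofReal)ᵀ * P)

theorem convex_setOf_posDef_neg_Mmat {n : ℕ} (β : ℂ) (P : Matrix (Fin n) (Fin n) ℂ) :
    Convex ℝ {A : Matrix (Fin n) (Fin n) ℝ | (-(Mmat β P A)).PosDef} := by
  rw [convex_iff_forall_pos]
  intro A hA B hB a b ha hb _
  have key : -(Mmat β P (a • A + b • B)) = a • -(Mmat β P A) + b • -(Mmat β P B) := by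
    have hmap : (a • A + b • B).map Complex.ofReal =
        a • A.map Complex.ofReal + b • B.map Complex.ofReal := by
      ext i j
      simp
    simp only [Mmat, hmap, Matrix.mul_add, Matrix.add_mul, Matrix.transpose_add,
      Matrix.transpose_smul, Matrix.mul_smul, Matrix.smul_mul, smul_add, smul_neg, neg_add]
    rw [smul_comm β a, smul_comm β b, smul_comm _ a, smul_comm _ b]
    abel
  rw [Set.mem_ofPred_eq, key]
  exact (hA.smul ha).add (hB.smul hb)

theorem mem_convexHull_vertices {ι κ : Type*} [Finite ι] [Finite κ]
    {L U A : ι → κ → ℝ} (hA : ∀ i j, L i j ≤ A i j ∧ A i j ≤ U i j) :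
    A ∈ convexHull ℝ {V : ι → κ → ℝ | ∀ i j, V i j = L i j ∨ V i j = U i j} := by
  have hV : {V : ι → κ → ℝ | ∀ i j, V i j = L i j ∨ V i j = U i j} =
      Set.univ.pi fun i => Set.univ.pi fun j => {L i j, U i j} := by
    ext V
    simp [Set.mem_pi]
  rw [hV]
  refine mem_convexHull_pi fun i _ => mem_convexHull_pi fun j _ => ?_
  rw [convexHull_pair, segment_eq_Icc ((hA i j).1.trans (hA i j).2)]
  exact hA i j

theorem stmt_9 (n : ℕ) (hn : 1 ≤ n) (β : ℂ)
    (L U : Matrix (Fin n) (Fin n) ℝ) (hLU : ∀ i j, L i j ≤ U i j)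
    (P : Matrix (Fin n) (Fin n) ℂ) (hP : P.PosDef)
    (hV : ∀ V ∈ {A : Matrix (Fin n) (Fin n) ℝ | ∀ i j, A i j = L i j ∨ A i j = U i j},
      (-(Mmat β P V)).PosDef) :
    ∀ A ∈ {A : Matrix (Fin n) (Fin n) ℝ | ∀ i j, L i j ≤ A i j ∧ A i j ≤ U i j},
      ∃ PA : Matrix (Fin n) (Fin n) ℂ, PA.PosDef ∧ (-(Mmat β PA A)).PosDef := by
  intro A hA
  exact ⟨P, hP, convexHull_min hV (convex_setOf_posDef_neg_Mmat β P) (mem_convexHull_vertices hA)⟩
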